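/- The self-shuffle of the full binary language, ss({0,1}*) = ⋃_{x ∈ {0,1}*} (x ∐ x), is not context-free. -/

import Mathlib

/-- `IsShuffle x y z` means `z` is an interleaving of `x` and `y`, preserving
the relative order of the letters of each; i.e. `z ∈ x ∐ y` (ordinary shuffle). -/
inductive IsShuffle {α : Type*} : List α → List α → List α → Prop
  | nil : IsShuffle [] [] []
  | left {x y z : List α} (a : α) : IsShuffle x y z → IsShuffle (a :: x) y (a :: z)
  | right {x y z : List α} (a : α) : IsShuffle x y z → IsShuffle x (a :: y) (a :: z)

/-! ### Derivation trees of bounded height -/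

section Pumping

variable {T : Type*} (g : ContextFreeGrammar T)

/-- `SymDer g n s w`: the symbol `s` derives the terminal word `w` by a tree of height at most `n`. -/
def SymDer : ℕ → Symbol T g.NT → List T → Prop
  | 0, .terminal t, w => w = [t]
  | 0, .nonterminal _, _ => False
  | _ + 1, .terminal t, w => w = [t]
  | n + 1, .nonterminal A, w => ∃ r ∈ g.rules, r.input = A ∧
      ∃ ws : List (List T), List.Forall₂ (fun s v => SymDer n s v) r.output ws ∧ ws.flatten = w

theorem symDer_terminal (n : ℕ) (t : T) (w : List T) :
    SymDer g n (.terminal t) w ↔ w = [t] := by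
  cases n <;> simp [SymDer]

theorem symDer_succ (n : ℕ) (s : Symbol T g.NT) (w : List T) (h : SymDer g n s w) :
    SymDer g (n + 1) s w := by
  induction n generalizing s w with
  | zero =>
    cases s with
    | terminal t => simpa [symDer_terminal] using h
    | nonterminal A => simp [SymDer] at h
  | succ n ih =>
    cases s with
    | terminal t => simpa [symDer_terminal] using h
    | nonterminal A =>
      obtain ⟨r, hr, hA, ws, h1, h2⟩ := h
      exact ⟨r, hr, hA, ws, h1.imp (fun s v hv => ih s v hv), h2⟩

theorem symDer_mono {n m : ℕ} (hnm : n ≤ m) {s : Symbol T g.NT} {w : List T}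
    (h : SymDer g n s w) : SymDer g m s w := by
  induction hnm with
  | refl => exact h
  | step _ ih => exact symDer_succ g _ _ _ ih

theorem derives_append {a b c d : List (Symbol T g.NT)} (h1 : g.Derives a b)
    (h2 : g.Derives c d) : g.Derives (a ++ c) (b ++ d) :=
  (h1.append_right c).trans (h2.append_left b)

theorem derives_of_forall {n : ℕ}
    (ih : ∀ (s : Symbol T g.NT) (w : List T), SymDer g n s w →
      g.Derives [s] (w.map Symbol.terminal))
    {l : List (Symbol T g.NT)} {ws : List (List T)}
    (h : List.Forall₂ (fun s v => SymDer g n s v) l ws) :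
    g.Derives l (ws.flatten.map Symbol.terminal) := by
  induction h with
  | nil => exact ContextFreeGrammar.Derives.refl _
  | @cons s v l ws hs _ ih2 =>
    have := derives_append g (ih s v hs) ih2
    simpa using this

theorem produces_rule {r : ContextFreeRule T g.NT} (hr : r ∈ g.rules) :
    g.Produces [.nonterminal r.input] r.output :=
  ⟨r, hr, ContextFreeRule.Rewrites.input_output⟩

theorem SymDer.derives {n : ℕ} {s : Symbol T g.NT} {w : List T} (h : SymDer g n s w) :
    g.Derives [s] (w.map Symbol.terminal) := by
  induction n generalizing s w with
  | zero =>
    cases s with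
    | terminal t =>
      rw [symDer_terminal] at h
      subst h
      exact ContextFreeGrammar.Derives.refl _
    | nonterminal A => simp [SymDer] at h
  | succ n ih =>
    cases s with
    | terminal t =>
      rw [symDer_terminal] at h
      subst h
      exact ContextFreeGrammar.Derives.refl _
    | nonterminal A =>
      obtain ⟨r, hr, rfl, ws, h1, rfl⟩ := h
      exact (produces_rule g hr).trans_derives (derives_of_forall g (fun s w => ih) h1)

theorem forall_split_left {α β : Type*} {R : α → β → Prop} {p q : List α} {ws : List β}
    (h : List.Forall₂ R (p ++ q) ws) :
    ∃ wp wq, ws = wp ++ wq ∧ List.Forall₂ R p wp ∧ List.Forall₂ R q wq := by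
  induction p generalizing ws with
  | nil => exact ⟨[], ws, rfl, .nil, h⟩
  | cons a p ih =>
    cases h with
    | cons h1 h2 =>
      obtain ⟨wp, wq, rfl, h3, h4⟩ := ih h2
      exact ⟨_ :: wp, wq, rfl, .cons h1 h3, h4⟩

theorem forall_append {α β : Type*} {R : α → β → Prop} {p q : List α} {wp wq : List β}
    (h1 : List.Forall₂ R p wp) (h2 : List.Forall₂ R q wq) :
    List.Forall₂ R (p ++ q) (wp ++ wq) := by
  induction h1 with
  | nil => exact h2
  | cons h _ ih => exact .cons h ih

theorem exists_symDer_of_derives {l : List (Symbol T g.NT)} {w : List T}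
    (h : g.Derives l (w.map Symbol.terminal)) :
    ∃ (n : ℕ) (ws : List (List T)), List.Forall₂ (fun s v => SymDer g n s v) l ws ∧
      ws.flatten = w := by
  induction h using Relation.ReflTransGen.head_induction_on with
  | refl =>
    refine ⟨0, w.map (fun t => [t]), ?_, ?_⟩
    · induction w with
      | nil => exact .nil
      | cons a w ih => exact .cons rfl ih
    · induction w with
      | nil => rfl
      | cons a w ih => simpa using ih
  | @head a b hab _ ih =>
    obtain ⟨n, ws, h1, h2⟩ := ih
    obtain ⟨r, hr, hrw⟩ := hab
    obtain ⟨p, q, rfl, rfl⟩ := hrw.exists_parts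
    obtain ⟨w12, wq, rfl, h12, hq⟩ := forall_split_left h1
    obtain ⟨wp, wo, rfl, hp, ho⟩ := forall_split_left h12
    refine ⟨n + 1, wp ++ [wo.flatten] ++ wq, ?_, by simpa using h2⟩
    refine forall_append (forall_append (hp.imp fun s v => symDer_succ g n s v) ?_)
      (hq.imp fun s v => symDer_succ g n s v)
    exact .cons ⟨r, hr, rfl, wo, ho, rfl⟩ .nil

/-- `A` derives `w`. -/
def Good (A : g.NT) (w : List T) : Prop := ∃ n, SymDer g n (.nonterminal A) w

/-- The least height of a tree. -/
noncomputable def rk (A : g.NT) (w : List T) : ℕ := sInf {n | SymDer g n (.nonterminal A) w}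

theorem rk_spec {A : g.NT} {w : List T} (h : Good g A w) :
    SymDer g (rk g A w) (.nonterminal A) w := Nat.sInf_mem (s := {n | SymDer g n (.nonterminal A) w}) h

theorem rk_le {A : g.NT} {w : List T} {n : ℕ} (h : SymDer g n (.nonterminal A) w) :
    rk g A w ≤ n := Nat.sInf_le h

/-- `l B r` is derivable from `A`. -/
def Ctx (A : g.NT) (l : List T) (B : g.NT) (r : List T) : Prop :=
  g.Derives [.nonterminal A]
    (l.map Symbol.terminal ++ [.nonterminal B] ++ r.map Symbol.terminal)

theorem Ctx.refl (A : g.NT) : Ctx g A [] A [] := ContextFreeGrammar.Derives.refl _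

variable {g} in
theorem Ctx.comp {A B C : g.NT} {l r l' r' : List T} (h1 : Ctx g A l B r)
    (h2 : Ctx g B l' C r') : Ctx g A (l ++ l') C (r' ++ r) := by
  have := h1.trans ((h2.append_left (l.map Symbol.terminal)).append_right (r.map Symbol.terminal))
  unfold Ctx
  simpa using this

variable {g} in
theorem Ctx.fill {A B : g.NT} {l r x : List T} (h1 : Ctx g A l B r)
    (h2 : g.Derives [.nonterminal B] (x.map Symbol.terminal)) :
    g.Derives [.nonterminal A] ((l ++ x ++ r).map Symbol.terminal) := by
  have := h1.trans ((h2.append_left (l.map Symbol.terminal)).append_right (r.map Symbol.terminal))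
  simpa using this

theorem exists_long {m k : ℕ} (ws : List (List T)) (h1 : ws.length ≤ m)
    (h2 : m * k < ws.flatten.length) : ∃ v ∈ ws, k < v.length := by
  by_contra! hcon
  have : ws.flatten.length ≤ ws.length * k := by
    clear h1 h2
    induction ws with
    | nil => simp
    | cons a ws ih =>
      have h3 := ih (fun v hv => hcon v (by simp [hv]))
      have h4 := hcon a (by simp)
      simp only [List.flatten_cons, List.length_append, List.length_cons]
      nlinarith
  nlinarith

/-- Going to a longest child. -/
theorem exists_child {m k : ℕ} (hm : ∀ r ∈ g.rules, r.output.length ≤ m) (hk : 1 ≤ k)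
    {A : g.NT} {w : List T} (hA : Good g A w) (hw : m * k < w.length) :
    ∃ (B : g.NT) (l v r : List T), Good g B v ∧ k < v.length ∧ w = l ++ v ++ r ∧
      Ctx g A l B r ∧ rk g B v < rk g A w := by
  have h := rk_spec g hA
  generalize hn : rk g A w = n at h
  cases n with
  | zero => simp [SymDer] at h
  | succ n =>
    obtain ⟨ρ, hρ, rfl, ws, h1, rfl⟩ := h
    obtain ⟨v, hv, hkv⟩ := exists_long ws (by rw [← h1.length_eq]; exact hm ρ hρ) hw
    obtain ⟨wp, wq, rfl⟩ := List.append_of_mem hv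
    obtain ⟨op, oq, ho, h3, h4⟩ := forall_split_left (R := fun v s => SymDer g n s v) h1.flip
    cases h4 with
    | @cons _ s _ oq h5 h6 =>
      cases s with
      | terminal t =>
        rw [symDer_terminal] at h5
        subst h5
        simp at hkv
        omega
      | nonterminal B =>
        refine ⟨B, wp.flatten, v, wq.flatten, ⟨n, h5⟩, hkv, by simp, ?_, ?_⟩
        · have hp := produces_rule g hρ
          rw [ho] at hp
          refine hp.trans_derives ?_
          have e1 := derives_of_forall g (fun s w => SymDer.derives g) h3.flip
          have e2 := derives_of_forall g (fun s w => SymDer.derives g) h6.flip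
          have := derives_append g (derives_append g e1
            (ContextFreeGrammar.Derives.refl [Symbol.nonterminal B])) e2
          simpa using this
        · have := rk_le g h5
          omega

/-- There is a short pump inside `(A, w)`, compatible with the colouring `f`. -/
def PumpIn {M : Type*} (f : List T → M) (p : ℕ) (A : g.NT) (w : List T) : Prop :=
  ∃ (B : g.NT) (u v x y z : List T), w = u ++ (v ++ x ++ y) ++ z ∧ Ctx g A u B z ∧
    Ctx g B v B y ∧ g.Derives [.nonterminal B] (x.map Symbol.terminal) ∧
    0 < v.length + y.length ∧ (v ++ x ++ y).length ≤ p ∧ f x = f (v ++ x ++ y)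

variable {g} in
theorem PumpIn.lift {M : Type*} {f : List T → M} {p : ℕ} {A B : g.NT} {l v r : List T}
    (h : PumpIn g f p B v) (hc : Ctx g A l B r) : PumpIn g f p A (l ++ v ++ r) := by
  obtain ⟨C, u, v, x, y, z, rfl, h1, h2, h3, h4, h5, h6⟩ := h
  exact ⟨C, l ++ u, v, x, y, z ++ r, by simp, hc.comp h1, h2, h3, h4, h5, h6⟩

theorem chain {M : Type*} [DecidableEq M] [DecidableEq g.NT] {f : List T → M} {m : ℕ}
    (hm1 : 1 ≤ m) (hm : ∀ r ∈ g.rules, r.output.length ≤ m) (p j : ℕ) (R : Finset (g.NT × M))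
    (hR : R.card ≤ j) (A : g.NT) (w : List T) (hA : Good g A w) (hw : m ^ j < w.length)
    (hwp : w.length ≤ p) :
    PumpIn g f p A w ∨ ∃ (B : g.NT) (l v r : List T), Good g B v ∧ w = l ++ v ++ r ∧
      Ctx g A l B r ∧ rk g B v ≤ rk g A w ∧ (B, f v) ∉ R := by
  induction j generalizing R A w with
  | zero =>
    have : R = ∅ := by simpa using hR
    subst this
    exact .inr ⟨A, [], w, [], hA, by simp, Ctx.refl g A, le_rfl, by simp⟩
  | succ j ih =>
    by_cases hc : (A, f w) ∈ R
    · obtain ⟨B, l, v, r, hB, hv, rfl, hctx, hrk⟩ :=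
        exists_child g hm (Nat.one_le_pow j m hm1) hA (by rw [pow_succ'] at hw; exact hw)
      have hcard : (R.erase (A, f (l ++ v ++ r))).card ≤ j := by
        rw [Finset.card_erase_of_mem hc]; omega
      rcases ih _ hcard B v hB hv (by simp at hwp; omega) with h | h
      · exact .inl (h.lift hctx)
      · obtain ⟨C, l', v', r', hC, rfl, hctx', hrk', hnot⟩ := h
        by_cases hCR : (C, f v') ∈ R
        · have heq : (C, f v') = (A, f (l ++ (l' ++ v' ++ r') ++ r)) := by
            by_contra hne
            exact hnot (Finset.mem_erase.2 ⟨hne, hCR⟩)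
          rw [Prod.mk.injEq] at heq
          obtain ⟨rfl, hf⟩ := heq
          have e : l ++ (l' ++ v' ++ r') ++ r = (l ++ l') ++ v' ++ (r' ++ r) := by simp
          refine .inl ⟨C, [], l ++ l', v', r' ++ r, [], by simp, Ctx.refl g C,
            hctx.comp hctx', ?_, ?_, ?_, ?_⟩
          · obtain ⟨n, hn⟩ := hC
            exact hn.derives
          · by_contra hzero
            have hl : l = [] := List.eq_nil_of_length_eq_zero (by simp at hzero; simp [hzero])
            have hl' : l' = [] := List.eq_nil_of_length_eq_zero (by simp at hzero; simp [hzero])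
            have hr : r = [] := List.eq_nil_of_length_eq_zero (by simp at hzero; simp [hzero])
            have hr' : r' = [] := List.eq_nil_of_length_eq_zero (by simp at hzero; simp [hzero])
            subst hl hl' hr hr'
            simp at hrk hrk'
            omega
          · rw [← e]; exact hwp
          · rw [← e]; exact hf
        · exact .inr ⟨C, l ++ l', v', r' ++ r, hC, by simp, hctx.comp hctx',
            hrk'.trans hrk.le, hCR⟩
    · exact .inr ⟨A, [], w, [], hA, by simp, Ctx.refl g A, le_rfl, hc⟩

theorem pump_exists {M : Type*} [Finite M] (f : List T → M) :
    ∃ p : ℕ, ∀ (A : g.NT) (w : List T), Good g A w → p < w.length → PumpIn g f p A w := by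
  classical
  have := Fintype.ofFinite M
  let F : Finset (g.NT × M) := (g.rules.image (fun r => r.input)) ×ˢ Finset.univ
  let m : ℕ := g.rules.sup (fun r => r.output.length) + 1
  have hm1 : 1 ≤ m := by simp [m]
  have hm : ∀ r ∈ g.rules, r.output.length ≤ m := fun r hr =>
    (Finset.le_sup (f := fun r : ContextFreeRule T g.NT => r.output.length) hr).trans
      (Nat.le_succ _)
  refine ⟨m * m ^ F.card, ?_⟩
  have key : ∀ (n : ℕ) (A : g.NT) (w : List T), rk g A w = n → Good g A w →
      m * m ^ F.card < w.length → PumpIn g f (m * m ^ F.card) A w := by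
    intro n
    induction n using Nat.strong_induction_on with
    | _ n ih =>
      intro A w hn hA hw
      obtain ⟨B, l, v, r, hB, hv, rfl, hctx, hrk⟩ :=
        exists_child g hm (Nat.one_le_pow _ m hm1) hA hw
      refine PumpIn.lift ?_ hctx
      by_cases hlong : m * m ^ F.card < v.length
      · exact ih _ (hn ▸ hrk) B v rfl hB hlong
      · rcases chain g hm1 hm (m * m ^ F.card) F.card F le_rfl B v hB hv (not_lt.1 hlong)
          with h | ⟨C, l', v', r', hC, -, -, -, hnot⟩
        · exact h
        · exfalso
          apply hnot
          obtain ⟨n, hn⟩ := hC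
          cases n with
          | zero => simp [SymDer] at hn
          | succ n =>
            obtain ⟨ρ, hρ, rfl, -⟩ := hn
            simp only [F, Finset.mem_product, Finset.mem_image, Finset.mem_univ, and_true]
            exact ⟨ρ, hρ, rfl⟩
  intro A w
  exact key _ A w rfl

/-- The pumping lemma, relative to a finite congruence `f`. -/
theorem coloured_pumping {L : Language T} (hL : L.IsContextFree) {M : Type*} [Finite M]
    (f : List T → M)
    (hf : ∀ u x x' z : List T, f x = f x' → f (u ++ x ++ z) = f (u ++ x' ++ z)) :
    ∃ p : ℕ, ∀ w ∈ L, p < w.length → ∃ u v x y z : List T,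
      w = u ++ (v ++ x ++ y) ++ z ∧ 0 < v.length + y.length ∧ (v ++ x ++ y).length ≤ p ∧
      (u ++ x ++ z ∈ L ∧ f (u ++ x ++ z) = f w) ∧
      (u ++ (v ++ (v ++ x ++ y) ++ y) ++ z ∈ L ∧
        f (u ++ (v ++ (v ++ x ++ y) ++ y) ++ z) = f w) := by
  obtain ⟨g, rfl⟩ := hL
  obtain ⟨p, hp⟩ := pump_exists g f
  refine ⟨p, fun w hw hlen => ?_⟩
  rw [ContextFreeGrammar.mem_language_iff] at hw
  obtain ⟨n, ws, h1, h2⟩ := exists_symDer_of_derives g hw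
  have hgood : Good g g.initial w := by
    cases h1 with
    | cons a b =>
      cases b
      simp at h2
      exact ⟨n, h2 ▸ a⟩
  obtain ⟨B, u, v, x, y, z, rfl, c1, c2, d, hpos, hle, hcol⟩ := hp _ w hgood hlen
  refine ⟨u, v, x, y, z, rfl, hpos, hle, ⟨?_, hf u _ _ z hcol⟩, ?_, ?_⟩
  · rw [ContextFreeGrammar.mem_language_iff]
    exact c1.fill d
  · rw [ContextFreeGrammar.mem_language_iff]
    exact c1.fill (c2.fill (c2.fill d))
  · exact hf u _ _ z (hf v _ _ y hcol).symm

end Pumping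

/-! ### Runs -/

theorem run_le {α : Type*} {p q : α} (hpq : p ≠ q) (a n : ℕ) (s t : List α)
    (h : List.replicate a p ++ q :: s = List.replicate n p ++ t) : n ≤ a := by
  induction a generalizing n with
  | zero =>
    cases n with
    | zero => rfl
    | succ n => simp [List.replicate_succ] at h; exact absurd h.1.symm hpq
  | succ a ih =>
    cases n with
    | zero => omega
    | succ n =>
      simp only [List.replicate_succ, List.cons_append, List.cons.injEq, true_and] at h
      have := ih n h
      omega

theorem run_le_right {α : Type*} {p q : α} (hpq : p ≠ q) (a n : ℕ) (s t : List α)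
    (h : s ++ q :: List.replicate a p = t ++ List.replicate n p) : n ≤ a := by
  have := congrArg List.reverse h
  simp at this
  exact run_le hpq a n s.reverse t.reverse (by simpa using this)

/-! ### Shuffles -/

theorem IsShuffle.split {α : Type*} {x y p q : List α} (h : IsShuffle x y (p ++ q)) :
    ∃ x1 x2 y1 y2, x = x1 ++ x2 ∧ y = y1 ++ y2 ∧ IsShuffle x1 y1 p ∧ IsShuffle x2 y2 q := by
  induction p generalizing x y with
  | nil => exact ⟨[], x, [], y, rfl, rfl, .nil, h⟩
  | cons a p ih =>
    rw [List.cons_append] at h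
    cases h with
    | left _ h =>
      obtain ⟨x1, x2, y1, y2, rfl, rfl, h1, h2⟩ := ih h
      exact ⟨a :: x1, x2, y1, y2, rfl, rfl, h1.left a, h2⟩
    | right _ h =>
      obtain ⟨x1, x2, y1, y2, rfl, rfl, h1, h2⟩ := ih h
      exact ⟨x1, x2, a :: y1, y2, rfl, rfl, h1.right a, h2⟩

theorem IsShuffle.of_replicate {α : Type*} {x y : List α} {n : ℕ} {s : α}
    (h : IsShuffle x y (List.replicate n s)) :
    ∃ i j, x = List.replicate i s ∧ y = List.replicate j s ∧ i + j = n := by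
  induction n generalizing x y with
  | zero =>
    rw [List.replicate_zero] at h
    cases h
    exact ⟨0, 0, rfl, rfl, rfl⟩
  | succ n ih =>
    rw [List.replicate_succ] at h
    cases h with
    | left _ h =>
      obtain ⟨i, j, rfl, rfl, hij⟩ := ih h
      exact ⟨i + 1, j, rfl, rfl, by omega⟩
    | right _ h =>
      obtain ⟨i, j, rfl, rfl, hij⟩ := ih h
      exact ⟨i, j + 1, rfl, rfl, by omega⟩

theorem isShuffle_append {α : Type*} (x y : List α) : IsShuffle x y (x ++ y) := by
  induction x with
  | nil =>
    induction y with
    | nil => exact .nil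
    | cons a y ih => exact ih.right a
  | cons a x ih => exact ih.left a

/-- The word `0^a 1^b 0^c 1^d`. -/
def blk (a b c d : ℕ) : List (Fin 2) :=
  List.replicate a 0 ++ List.replicate b 1 ++ List.replicate c 0 ++ List.replicate d 1

theorem count_zero_blk (a b c d : ℕ) : (blk a b c d).count 0 = a + c := by
  simp [blk, List.count_replicate]

theorem count_one_blk (a b c d : ℕ) : (blk a b c d).count 1 = b + d := by
  simp [blk, List.count_replicate]

theorem blk_prefix_le {a b c d n : ℕ} {t : List (Fin 2)} (hb : 0 < b)
    (h : blk a b c d = List.replicate n 0 ++ t) : n ≤ a := by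
  obtain ⟨b, rfl⟩ := Nat.exists_eq_succ_of_ne_zero hb.ne'
  exact run_le (p := (0 : Fin 2)) (q := 1) (by decide) a n _ t
    (by rw [← h]; simp only [blk, List.replicate_succ, List.append_assoc, List.cons_append]; rfl)

theorem blk_suffix_le {a b c d n : ℕ} {t : List (Fin 2)} (hc : 0 < c)
    (h : blk a b c d = t ++ List.replicate n 1) : n ≤ d := by
  obtain ⟨c, rfl⟩ := Nat.exists_eq_succ_of_ne_zero hc.ne'
  exact run_le_right (p := (1 : Fin 2)) (q := 0) (by decide) d n
    (List.replicate a 0 ++ List.replicate b 1 ++ List.replicate c 0) t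
    (by rw [← h]; simp [blk, List.replicate_succ'])

theorem blk_le_prefix {a b c d n : ℕ} {t : List (Fin 2)}
    (h : blk a b c d = List.replicate n 0 ++ 1 :: t) : a ≤ n :=
  run_le (p := (0 : Fin 2)) (q := 1) (by decide) n a t
    (List.replicate b 1 ++ List.replicate c 0 ++ List.replicate d 1)
    (by rw [← h]; simp [blk])

theorem blk_le_suffix {a b c d n : ℕ} {t : List (Fin 2)}
    (h : blk a b c d = t ++ 0 :: List.replicate n 1) : d ≤ n :=
  run_le_right (p := (1 : Fin 2)) (q := 0) (by decide) n d t
    (List.replicate a 0 ++ List.replicate b 1 ++ List.replicate c 0)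
    (by rw [← h]; simp [blk])

theorem blk_core {a1 b1 c1 d1 a2 b2 c2 d2 : ℕ} (h : blk a1 b1 c1 d1 = blk a2 b2 c2 d2)
    (hlt : a1 < a2) (hb : 0 < b1 + b2) : b1 = 0 ∧ c2 = 0 := by
  have e1 := congrArg (List.count 1) h
  simp only [count_one_blk] at e1
  have hb1 : b1 = 0 := by
    by_contra hne
    have := blk_prefix_le (n := a2) (t := List.replicate b2 1 ++ List.replicate c2 0 ++
      List.replicate d2 1) (Nat.pos_of_ne_zero hne) (by rw [h]; simp [blk])
    omega
  refine ⟨hb1, ?_⟩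
  by_contra hne
  have := blk_suffix_le (n := d1) (t := List.replicate a1 0 ++ List.replicate b1 1 ++
    List.replicate c1 0) (Nat.pos_of_ne_zero hne) (by rw [← h]; simp [blk])
  omega

theorem shuffle_blk {a b c d : ℕ} (ha : a % 2 = 1) (hb : b % 2 = 1) {x : List (Fin 2)}
    (h : IsShuffle x x (blk a b c d)) : c ≤ a ∧ b ≤ d := by
  obtain ⟨x123, x4, y123, y4, hx, hy, h123, h4⟩ := h.split
  obtain ⟨x12, x3, y12, y3, rfl, rfl, h12, h3⟩ := h123.split
  obtain ⟨x1, x2, y1, y2, rfl, rfl, h1, h2⟩ := h12.split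
  obtain ⟨a1, a2, rfl, rfl, rfl⟩ := h1.of_replicate
  obtain ⟨b1, b2, rfl, rfl, rfl⟩ := h2.of_replicate
  obtain ⟨c1, c2, rfl, rfl, rfl⟩ := h3.of_replicate
  obtain ⟨d1, d2, rfl, rfl, rfl⟩ := h4.of_replicate
  have e : blk a1 b1 c1 d1 = blk a2 b2 c2 d2 := hx.symm.trans hy
  have e0 := congrArg (List.count 0) e
  have e1 := congrArg (List.count 1) e
  simp only [count_zero_blk, count_one_blk] at e0 e1
  rcases lt_trichotomy a1 a2 with hlt | heq | hlt
  · have := blk_core e hlt (by omega)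
    omega
  · omega
  · have := blk_core e.symm hlt (by omega)
    omega

/-! ### The automaton for odd blocks -/

/-- Transition table on states `0..8`, where `8` is the sink. -/
def stp (s : Fin 9) (t : Fin 2) : Fin 9 :=
  match s, t with
  | 0, 0 => 1
  | 0, 1 => 8
  | 1, 0 => 0
  | 1, 1 => 2
  | 2, 0 => 4
  | 2, 1 => 3
  | 3, 0 => 8
  | 3, 1 => 2
  | 4, 0 => 5
  | 4, 1 => 6
  | 5, 0 => 4
  | 5, 1 => 8
  | 6, 0 => 8
  | 6, 1 => 7
  | 7, 0 => 8
  | 7, 1 => 6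
  | 8, _ => 8

/-- The action of a word on the states. -/
def act (w : List (Fin 2)) : Fin 9 → Fin 9 := fun s => w.foldl stp s

theorem act_congr (u x x' z : List (Fin 2)) (h : act x = act x') :
    act (u ++ x ++ z) = act (u ++ x' ++ z) := by
  funext s
  have := congrFun h (u.foldl stp s)
  simp only [act, List.foldl_append] at this ⊢
  rw [this]

/-- What a word leading to a given state looks like. -/
def RunInv (w : List (Fin 2)) (s : Fin 9) : Prop :=
  match s with
  | 0 => ∃ a, w = blk a 0 0 0 ∧ a % 2 = 0
  | 1 => ∃ a, w = blk a 0 0 0 ∧ a % 2 = 1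
  | 2 => ∃ a b, w = blk a b 0 0 ∧ a % 2 = 1 ∧ b % 2 = 1
  | 3 => ∃ a b, w = blk a b 0 0 ∧ a % 2 = 1 ∧ b % 2 = 0
  | 4 => ∃ a b c, w = blk a b c 0 ∧ a % 2 = 1 ∧ b % 2 = 1 ∧ c % 2 = 1
  | 5 => ∃ a b c, w = blk a b c 0 ∧ a % 2 = 1 ∧ b % 2 = 1 ∧ c % 2 = 0
  | 6 => ∃ a b c d, w = blk a b c d ∧ a % 2 = 1 ∧ b % 2 = 1 ∧ c % 2 = 1 ∧ d % 2 = 1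
  | 7 => ∃ a b c d, w = blk a b c d ∧ a % 2 = 1 ∧ b % 2 = 1 ∧ c % 2 = 1 ∧ d % 2 = 0
  | 8 => True

theorem blk_snoc_a (a : ℕ) : blk a 0 0 0 ++ [0] = blk (a + 1) 0 0 0 := by
  simp [blk, List.replicate_succ']
theorem blk_snoc_b (a b : ℕ) : blk a b 0 0 ++ [1] = blk a (b + 1) 0 0 := by
  simp [blk, List.replicate_succ']
theorem blk_snoc_c (a b c : ℕ) : blk a b c 0 ++ [0] = blk a b (c + 1) 0 := by
  simp [blk, List.replicate_succ']
theorem blk_snoc_d (a b c d : ℕ) : blk a b c d ++ [1] = blk a b c (d + 1) := by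
  simp [blk, List.replicate_succ']

theorem inv_stp (w : List (Fin 2)) (s : Fin 9) (t : Fin 2) (h : RunInv w s) :
    RunInv (w ++ [t]) (stp s t) := by
  match s, t with
  | 0, 0 => obtain ⟨a, rfl, h⟩ := h; exact ⟨a + 1, blk_snoc_a a, by omega⟩
  | 0, 1 => trivial
  | 1, 0 => obtain ⟨a, rfl, h⟩ := h; exact ⟨a + 1, blk_snoc_a a, by omega⟩
  | 1, 1 => obtain ⟨a, rfl, h⟩ := h; exact ⟨a, 1, blk_snoc_b a 0, by omega, by omega⟩
  | 2, 0 =>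
    obtain ⟨a, b, rfl, h⟩ := h
    exact ⟨a, b, 1, blk_snoc_c a b 0, by omega, by omega, by omega⟩
  | 2, 1 => obtain ⟨a, b, rfl, h⟩ := h; exact ⟨a, b + 1, blk_snoc_b a b, by omega, by omega⟩
  | 3, 0 => trivial
  | 3, 1 => obtain ⟨a, b, rfl, h⟩ := h; exact ⟨a, b + 1, blk_snoc_b a b, by omega, by omega⟩
  | 4, 0 =>
    obtain ⟨a, b, c, rfl, h⟩ := h
    exact ⟨a, b, c + 1, blk_snoc_c a b c, by omega, by omega, by omega⟩
  | 4, 1 =>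
    obtain ⟨a, b, c, rfl, h⟩ := h
    exact ⟨a, b, c, 1, blk_snoc_d a b c 0, by omega, by omega, by omega, by omega⟩
  | 5, 0 =>
    obtain ⟨a, b, c, rfl, h⟩ := h
    exact ⟨a, b, c + 1, blk_snoc_c a b c, by omega, by omega, by omega⟩
  | 5, 1 => trivial
  | 6, 0 => trivial
  | 6, 1 =>
    obtain ⟨a, b, c, d, rfl, h⟩ := h
    exact ⟨a, b, c, d + 1, blk_snoc_d a b c d, by omega, by omega, by omega, by omega⟩
  | 7, 0 => trivial
  | 7, 1 =>
    obtain ⟨a, b, c, d, rfl, h⟩ := h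
    exact ⟨a, b, c, d + 1, blk_snoc_d a b c d, by omega, by omega, by omega, by omega⟩
  | 8, 0 => trivial
  | 8, 1 => trivial

theorem inv_act (w : List (Fin 2)) : RunInv w (act w 0) := by
  induction w using List.reverseRecOn with
  | nil => exact ⟨0, rfl, rfl⟩
  | append_singleton w t ih =>
    have := inv_stp w _ t ih
    simpa [act] using this

theorem foldl_odd (s s' : Fin 9) (t : Fin 2) (h1 : stp s t = s') (h2 : stp (stp s' t) t = s')
    (k : ℕ) : (List.replicate (2 * k + 1) t).foldl stp s = s' := by
  induction k with
  | zero => simpa using h1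
  | succ k ih =>
    rw [show 2 * (k + 1) + 1 = 2 * k + 1 + 1 + 1 by ring, List.replicate_succ',
      List.replicate_succ', List.foldl_append, List.foldl_append, ih]
    exact h2

theorem act_blk (k : ℕ) :
    act (blk (2 * k + 1) (2 * k + 1) (2 * k + 1) (2 * k + 1)) 0 = 6 := by
  simp only [act, blk, List.foldl_append]
  rw [foldl_odd 0 1 0 rfl rfl, foldl_odd 1 2 1 rfl rfl, foldl_odd 2 4 0 rfl rfl,
    foldl_odd 4 6 1 rfl rfl]

/-! ### The combinatorial contradiction -/

theorem exists_blk {w : List (Fin 2)} (hL : ∃ x, IsShuffle x x w) (hw : act w 0 = 6) :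
    ∃ a b c d, w = blk a b c d ∧ 0 < b ∧ 0 < c ∧ c ≤ a ∧ b ≤ d := by
  have := inv_act w
  rw [hw] at this
  obtain ⟨a, b, c, d, rfl, ha, hb, hc, hd⟩ := this
  obtain ⟨x, hx⟩ := hL
  exact ⟨a, b, c, d, rfl, by omega, by omega, shuffle_blk ha hb hx⟩

/-- If a word ends with `0^n 1^n`, its last two blocks are controlled. -/
theorem blk_end {a b c d n : ℕ} {t : List (Fin 2)} (hn : 0 < n) (hb : 0 < b) (hc : 0 < c)
    (h : blk a b c d = t ++ (List.replicate n 0 ++ List.replicate n 1)) : d = n ∧ n ≤ c := by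
  obtain ⟨m, rfl⟩ := Nat.exists_eq_succ_of_ne_zero hn.ne'
  have h1 : d = m + 1 := le_antisymm
    (blk_le_suffix (t := t ++ List.replicate m 0) (by rw [h]; simp [List.replicate_succ' (n := m)
      (a := (0 : Fin 2))]))
    (blk_suffix_le (t := t ++ List.replicate (m + 1) 0) hc (by rw [h]; simp))
  refine ⟨h1, ?_⟩
  subst h1
  rw [← List.append_assoc, blk] at h
  have h2 := List.append_cancel_right h
  obtain ⟨b, rfl⟩ := Nat.exists_eq_succ_of_ne_zero hb.ne'
  exact run_le_right (p := (0 : Fin 2)) (q := 1) (by decide) c (m + 1)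
    (List.replicate a 0 ++ List.replicate b 1) t (by rw [← h2]; simp [List.replicate_succ'])

theorem blk_start {a b c d n : ℕ} {t : List (Fin 2)} (hn : 0 < n) (hb : 0 < b) (hc : 0 < c)
    (h : blk a b c d = (List.replicate n 0 ++ List.replicate n 1) ++ t) : a = n ∧ n ≤ b := by
  obtain ⟨m, rfl⟩ := Nat.exists_eq_succ_of_ne_zero hn.ne'
  have h1 : a = m + 1 := le_antisymm
    (blk_le_prefix (t := List.replicate m 1 ++ t) (by rw [h]; simp [List.replicate_succ (n := m)
      (a := (1 : Fin 2))]))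
    (blk_prefix_le (t := List.replicate (m + 1) 1 ++ t) hb (by rw [h]; simp))
  refine ⟨h1, ?_⟩
  subst h1
  simp only [blk, List.append_assoc] at h
  have h2 := List.append_cancel_left h
  obtain ⟨c, rfl⟩ := Nat.exists_eq_succ_of_ne_zero hc.ne'
  exact run_le (p := (1 : Fin 2)) (q := 0) (by decide) b (m + 1)
    (List.replicate c 0 ++ List.replicate d 1) t (by rw [← h2]; simp [List.replicate_succ])

theorem head_pump {α : Type*} {u v x y z s : List α} {q : α}
    (h : u ++ (v ++ x ++ y) ++ z = q :: s) :
    ∃ s', u ++ (v ++ (v ++ x ++ y) ++ y) ++ z = q :: s' := by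
  cases u with
  | cons a u => simp at h; simp [h.1]
  | nil =>
    cases v with
    | cons a v => simp at h; simp [h.1]
    | nil =>
      cases x with
      | cons a x => simp at h; simp [h.1]
      | nil =>
        cases y with
        | cons a y => simp at h; simp [h.1]
        | nil => exact ⟨s, by simpa using h⟩

theorem last_pump {α : Type*} {u v x y z s : List α} {q : α}
    (h : u ++ (v ++ x ++ y) ++ z = s ++ [q]) :
    ∃ s', u ++ (v ++ (v ++ x ++ y) ++ y) ++ z = s' ++ [q] := by
  have h1 := congrArg List.reverse h
  obtain ⟨s', hs'⟩ := head_pump (u := z.reverse) (v := y.reverse) (x := x.reverse)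
    (y := v.reverse) (z := u.reverse) (q := q) (s := s.reverse) (by simpa using h1)
  refine ⟨s'.reverse, ?_⟩
  have h2 := congrArg List.reverse hs'
  simpa using h2

theorem count_length (l : List (Fin 2)) : l.count 0 + l.count 1 = l.length := by
  induction l with
  | nil => rfl
  | cons a l ih => fin_cases a <;> simp <;> omega

theorem no_pump {n : ℕ} (hn : 0 < n) {u v x y z : List (Fin 2)}
    (hw : blk n n n n = u ++ (v ++ x ++ y) ++ z) (hpos : 0 < v.length + y.length)
    (hle : (v ++ x ++ y).length ≤ n)
    {a b c d a' b' c' d' : ℕ}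
    (h0 : u ++ x ++ z = blk a b c d) (hb : 0 < b) (hc : 0 < c) (hca : c ≤ a) (hbd : b ≤ d)
    (h2 : u ++ (v ++ (v ++ x ++ y) ++ y) ++ z = blk a' b' c' d') (hb' : 0 < b') (hc' : 0 < c')
    (hca' : c' ≤ a') (hbd' : b' ≤ d') : False := by
  have k0 := congrArg (List.count 0) hw
  have k1 := congrArg (List.count 1) hw
  have l0 := congrArg (List.count 0) h0
  have l1 := congrArg (List.count 1) h0
  have m0 := congrArg (List.count 0) h2
  have m1 := congrArg (List.count 1) h2
  have cv := count_length v
  have cy := count_length y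
  have len := congrArg List.length hw
  simp only [count_zero_blk, count_one_blk, List.count_append] at k0 k1 l0 l1 m0 m1
  simp only [List.length_append, blk, List.length_replicate] at len hle
  by_cases hA : u.length + (v.length + x.length + y.length) ≤ 2 * n
  · -- the pump is inside the first two blocks
    have hw' : (List.replicate n (0 : Fin 2) ++ List.replicate n 1) ++
        (List.replicate n 0 ++ List.replicate n 1) = (u ++ (v ++ x ++ y)) ++ z := by
      rw [← hw]; simp [blk]
    obtain ⟨z', hz⟩ : ∃ z', z = z' ++ (List.replicate n (0 : Fin 2) ++ List.replicate n 1) := by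
      rcases List.append_eq_append_iff.1 hw' with ⟨t, e1, e2⟩ | ⟨t, e1, e2⟩
      · have e3 := congrArg List.length e1
        simp at e3
        have : t = [] := List.eq_nil_of_length_eq_zero (by omega)
        subst this
        exact ⟨[], by simpa using e2.symm⟩
      · exact ⟨t, e2⟩
    subst hz
    have r0 := blk_end (t := u ++ x ++ z') hn hb hc (by rw [← h0]; simp)
    have r2 := blk_end (t := u ++ (v ++ (v ++ x ++ y) ++ y) ++ z') hn hb' hc'
      (by rw [← h2]; simp)
    omega
  by_cases hB : 2 * n ≤ u.length
  · -- the pump is inside the last two blocks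
    have hw' : (List.replicate n (0 : Fin 2) ++ List.replicate n 1) ++
        (List.replicate n 0 ++ List.replicate n 1) = u ++ ((v ++ x ++ y) ++ z) := by
      rw [← List.append_assoc u, ← hw]; simp [blk]
    obtain ⟨u', hu⟩ : ∃ u', u = (List.replicate n (0 : Fin 2) ++ List.replicate n 1) ++ u' := by
      rcases List.append_eq_append_iff.1 hw' with ⟨t, e1, e2⟩ | ⟨t, e1, e2⟩
      · exact ⟨t, e1⟩
      · have e3 := congrArg List.length e1
        simp at e3
        have : t = [] := List.eq_nil_of_length_eq_zero (by omega)
        subst this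
        exact ⟨[], by simpa using e1.symm⟩
    subst hu
    have r0 := blk_start (t := u' ++ x ++ z) hn hb hc (by rw [← h0]; simp)
    have r2 := blk_start (t := u' ++ (v ++ (v ++ x ++ y) ++ y) ++ z) hn hb' hc'
      (by rw [← h2]; simp)
    omega
  · -- the pump is inside the middle two blocks
    have hw' : List.replicate n (0 : Fin 2) ++ (List.replicate n 1 ++
        (List.replicate n 0 ++ List.replicate n 1)) = u ++ ((v ++ x ++ y) ++ z) := by
      rw [← List.append_assoc u, ← hw]; simp [blk]
    obtain ⟨u', hu⟩ : ∃ u', u = List.replicate n (0 : Fin 2) ++ u' := by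
      rcases List.append_eq_append_iff.1 hw' with ⟨t, e1, e2⟩ | ⟨t, e1, e2⟩
      · exact ⟨t, e1⟩
      · have e3 := congrArg List.length e1
        simp at e3
        omega
    subst hu
    simp only [List.append_assoc] at hw'
    have hw2 := List.append_cancel_left hw'
    have hw3 : (List.replicate n (1 : Fin 2) ++ List.replicate n 0) ++ List.replicate n 1 =
        (u' ++ (v ++ x ++ y)) ++ z := by
      simpa using hw2
    simp only [List.length_append, List.length_replicate] at len hA hB
    obtain ⟨z', hz⟩ : ∃ z', z = z' ++ List.replicate n (1 : Fin 2) := by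
      rcases List.append_eq_append_iff.1 hw3 with ⟨t, e1, e2⟩ | ⟨t, e1, e2⟩
      · have e3 := congrArg List.length e1
        simp at e3
        have : t = [] := List.eq_nil_of_length_eq_zero (by omega)
        subst this
        exact ⟨[], by simpa using e2.symm⟩
      · exact ⟨t, e2⟩
    subst hz
    rw [← List.append_assoc] at hw3
    have hw4 := List.append_cancel_right hw3
    obtain ⟨m, rfl⟩ := Nat.exists_eq_succ_of_ne_zero hn.ne'
    obtain ⟨s, hs⟩ := head_pump (q := (1 : Fin 2)) (s := List.replicate m 1 ++
      List.replicate (m + 1) 0) (hw4.symm.trans (by simp [List.replicate_succ]))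
    obtain ⟨s', hs'⟩ := last_pump (q := (0 : Fin 2)) (s := List.replicate (m + 1) 1 ++
      List.replicate m 0) (hw4.symm.trans (by simp [List.replicate_succ']))
    have r1 : a' ≤ m + 1 := blk_le_prefix (t := s ++ List.replicate (m + 1) 1) (by
      rw [← h2, ← List.cons_append, ← hs]; simp)
    have r2 : d' ≤ m + 1 := blk_le_suffix (t := List.replicate (m + 1) 0 ++ s') (by
      rw [← h2, List.append_cons, List.append_assoc _ s', ← hs']; simp)
    omega

/-- The self-shuffle of the full binary language,
ss({0,1}*) = ⋃ₓ (x ∐ x), is not context-free. -/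
theorem selfShuffle_not_contextFree :
    ¬ Language.IsContextFree {w : List (Fin 2) | ∃ x : List (Fin 2), IsShuffle x x w} := by
  intro hCF
  obtain ⟨p, hp⟩ := coloured_pumping hCF act act_congr
  have hmem : ∃ x, IsShuffle x x (blk (2 * p + 1) (2 * p + 1) (2 * p + 1) (2 * p + 1)) := by
    refine ⟨List.replicate (2 * p + 1) 0 ++ List.replicate (2 * p + 1) 1, ?_⟩
    have := isShuffle_append (List.replicate (2 * p + 1) (0 : Fin 2) ++
      List.replicate (2 * p + 1) 1) (List.replicate (2 * p + 1) 0 ++ List.replicate (2 * p + 1) 1)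
    simpa only [blk, List.append_assoc] using this
  obtain ⟨u, v, x, y, z, hw, hpos, hle, ⟨m0, f0⟩, m2, f2⟩ := hp _ hmem (by simp [blk]; omega)
  have hact := act_blk p
  obtain ⟨a, b, c, d, e, hb, hc, hca, hbd⟩ := exists_blk m0 (by rw [f0]; exact hact)
  obtain ⟨a', b', c', d', e', hb', hc', hca', hbd'⟩ := exists_blk m2 (by rw [f2]; exact hact)
  exact no_pump (by omega) hw hpos (by omega) e hb hc hca hbd e' hb' hc' hca' hbd'
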